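/- Let 1 ≤ p < ∞, r ∈ ℕ, σ > 0, let γ ∈ (0,1] be the separation parameter of X_σ, and let f ∈ L_p(ℝ^d) be a bounded function. Then for every 0 < δ ≤ γ/σ one has ‖f_{δ,r} − f‖_{ℓ_p(X_σ)} ≤ C (δσ)^{−d/p} τ_{2r}(f,δ)_p, where the constant C depends only on r, γ, and d. If, in addition, f is continuous on ℝ^d and 2r > d/p, then ‖f_{δ,r} − f‖_{ℓ_p(X_σ)} ≤ C σ^{−d/p} ∫_0^δ ω_{2r}(f,t)_p t^{−d/p} dt/t. -/

import Mathlib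

open MeasureTheory ENNReal Metric Filter
open scoped BigOperators FourierTransform

noncomputable section

/-- Euclidean space ℝ^d. -/
abbrev Euc (d : ℕ) := EuclideanSpace ℝ (Fin d)

/-- The `L_p(ℝ^d)` (quasi-)norm, valued in `ℝ≥0∞`. -/
def LpN {d : ℕ} (p : ℝ) (f : Euc d → ℝ) : ℝ≥0∞ :=
  eLpNorm f (ENNReal.ofReal p) volume

/-- Membership `f ∈ L_p(ℝ^d)`. -/
def MemLpR {d : ℕ} (p : ℝ) (f : Euc d → ℝ) : Prop :=
  AEStronglyMeasurable f volume ∧ LpN p f ≠ ∞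

/-- The difference operator `Δ_h^r f`. -/
def diffOp {d : ℕ} (h : Euc d) (r : ℕ) (f : Euc d → ℝ) : Euc d → ℝ :=
  fun x => ∑ ν ∈ Finset.range (r + 1),
    (r.choose ν : ℝ) * (-1 : ℝ) ^ ν * f (x + ((r - ν : ℕ) : ℝ) • h)

/-- The modulus of smoothness `ω_r(f,δ)_p`. -/
def smod {d : ℕ} (p : ℝ) (r : ℕ) (f : Euc d → ℝ) (δ : ℝ) : ℝ≥0∞ :=
  ⨆ (h : Euc d) (_ : ‖h‖ < δ), LpN p (diffOp h r f)

/-- The discrete semi-norm `‖f‖_{ℓ_p(X_σ)} = (σ^{-d} ∑_{ξ∈X} |f(ξ)|^p)^{1/p}`. -/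
def lpX {d : ℕ} (p σ : ℝ) (X : Set (Euc d)) (f : Euc d → ℝ) : ℝ≥0∞ :=
  ((ENNReal.ofReal σ)⁻¹ ^ d * ∑' ξ : X, ENNReal.ofReal (|f ξ.1| ^ p)) ^ (1 / p)

/-- Separation property of the sampling set: distinct points of `X` are at distance `> 2γ/σ`. -/
def Separated {d : ℕ} (γ σ : ℝ) (X : Set (Euc d)) : Prop :=
  ∀ ξ ∈ X, ∀ ξ' ∈ X, ξ ≠ ξ' → 2 * γ / σ < dist ξ ξ'

/-- Ball average `f_δ(x) = |B_δ|⁻¹ ∫_{B_δ(x)} f`. -/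
def ballAvg {d : ℕ} (f : Euc d → ℝ) (δ : ℝ) (x : Euc d) : ℝ :=
  ⨍ y in ball x δ, f y

/-- The special averaged operator `f_{δ,r}`. -/
def avgOp {d : ℕ} (f : Euc d → ℝ) (δ : ℝ) (r : ℕ) : Euc d → ℝ := fun x =>
  -(2 / ((2 * r).choose r : ℝ)) *
    ∑ j ∈ Finset.Icc 1 r,
      (-1 : ℝ) ^ j * ((2 * r).choose (r - j) : ℝ) * ballAvg f (δ * j / r) x

/-- The local modulus of smoothness `ω_r(f,x,δ)` (valued in `ℝ≥0∞`). -/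
def localMod {d : ℕ} (r : ℕ) (f : Euc d → ℝ) (x : Euc d) (δ : ℝ) : ℝ≥0∞ :=
  ⨆ (t : Euc d) (h : Euc d)
    (_ : t ∈ ball x ((r : ℝ) * δ / 2) ∧ t + (r : ℝ) • h ∈ ball x ((r : ℝ) * δ / 2)),
      ENNReal.ofReal |diffOp h r f t|

/-- The averaged modulus of smoothness (`τ`-modulus) `τ_r(f,δ)_p`. -/
def tauMod {d : ℕ} (p : ℝ) (r : ℕ) (f : Euc d → ℝ) (δ : ℝ) : ℝ≥0∞ :=
  (∫⁻ x, localMod r f x δ ^ p) ^ (1 / p)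

/-- First-order partial derivative in the `i`-th coordinate direction. -/
def pderiv' {d : ℕ} (i : Fin d) (f : Euc d → ℝ) : Euc d → ℝ :=
  fun x => fderiv ℝ f x (EuclideanSpace.single i 1)

/-- The mixed partial derivative `D^α` for a multi-index `α`. -/
def Dmulti {d : ℕ} (α : Fin d → ℕ) (f : Euc d → ℝ) : Euc d → ℝ :=
  ((List.ofFn fun i : Fin d => (pderiv' i)^[α i]).foldr (· ∘ ·) id) f

/-- The Sobolev semi-norm `|f|_{W_p^s} = ∑_{|α|₁ = s} ‖D^α f‖_p`. -/
def sobolevSemi {d : ℕ} (p : ℝ) (s : ℕ) (f : Euc d → ℝ) : ℝ≥0∞ :=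
  ∑' α : {α : Fin d → ℕ // ∑ i, α i = s}, LpN p (Dmulti α.1 f)

/-- Membership in the Sobolev space `W_p^s(ℝ^d)`. -/
def MemSobolev {d : ℕ} (p : ℝ) (s : ℕ) (f : Euc d → ℝ) : Prop :=
  MemLpR p f ∧ ∀ α : Fin d → ℕ, (∑ i, α i) ≤ s → MemLpR p (Dmulti α f)

/-- The class of band-limited functions `B_p^σ(ℝ^d)`:
functions in `L_p ∩ L_1` whose Fourier transform is supported in `[-σ,σ]^d`. -/
def MemBandlimited {d : ℕ} (p σ : ℝ) (φ : Euc d → ℝ) : Prop :=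
  MemLpR p φ ∧ Integrable φ ∧
    Function.support (𝓕 fun x : Euc d => (φ x : ℂ)) ⊆ {ξ : Euc d | ∀ i, |ξ i| ≤ σ}

/-- Assumption (A₁): `‖G f‖_p ≤ κ ‖f‖_{ℓ_p(X_σ)}` for `f ∈ L_p ∩ ℓ_p(X_σ)`. -/
def AssumpA1 {d : ℕ} (p σ : ℝ) (X : Set (Euc d)) (G : (Euc d → ℝ) → Euc d → ℝ)
    (κ : ℝ≥0∞) : Prop :=
  ∀ f : Euc d → ℝ, MemLpR p f → lpX p σ X f ≠ ∞ → LpN p (G f) ≤ κ * lpX p σ X f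

/-- Assumption (A₂): `κ ‖f‖_{ℓ_p(X_σ)} ≤ ‖G f‖_p` for `f ∈ L_p ∩ ℓ_p(X_σ)`. -/
def AssumpA2 {d : ℕ} (p σ : ℝ) (X : Set (Euc d)) (G : (Euc d → ℝ) → Euc d → ℝ)
    (κ : ℝ≥0∞) : Prop :=
  ∀ f : Euc d → ℝ, MemLpR p f → lpX p σ X f ≠ ∞ → κ * lpX p σ X f ≤ LpN p (G f)

/-- Assumption (A₃): `‖g - G g‖_p ≤ κ σ^{-s} |g|_{W_p^s}` for all `g ∈ B_p^{λσ}(ℝ^d)`. -/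
def AssumpA3 {d : ℕ} (p σ : ℝ) (G : (Euc d → ℝ) → Euc d → ℝ) (s : ℕ) (lam : ℝ)
    (κ : ℝ≥0∞) : Prop :=
  ∀ g : Euc d → ℝ, MemBandlimited p (lam * σ) g →
    LpN p (g - G g) ≤ κ * (ENNReal.ofReal σ)⁻¹ ^ s * sobolevSemi p s g

/-- The error of best approximation `E(f,Φ)_p`. -/
def bestApprox {d : ℕ} (p : ℝ) (Φ : Set (Euc d → ℝ)) (f : Euc d → ℝ) : ℝ≥0∞ :=
  ⨅ (g : Euc d → ℝ) (_ : g ∈ Φ), LpN p (f - g)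

/-- Structural properties of the family of approximation subspaces `Φ = (Φ_σ)_{σ ≥ 0}`. -/
def PhiFamily {d : ℕ} (Φ : ℝ → Set (Euc d → ℝ)) : Prop :=
  (∀ σ : ℝ, 0 < σ → (0 : Euc d → ℝ) ∈ Φ σ) ∧
  Φ 0 = {0} ∧
  (∀ a : ℝ, a ≠ 0 → ∀ σ : ℝ, 0 < σ → (fun g : Euc d → ℝ => a • g) '' Φ σ = Φ σ) ∧
  (∃ c : ℝ, 0 < c ∧ ∀ σ : ℝ, 0 < σ → ∀ g₁ ∈ Φ σ, ∀ g₂ ∈ Φ σ, g₁ + g₂ ∈ Φ (c * σ))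

/-- Jackson-type inequality for the family `Φ`:
`E(f,Φ_σ)_p ≤ c σ^{-s} |f|_{W_p^s}` for `f ∈ W_p^s`. -/
def JacksonIneq {d : ℕ} (p : ℝ) (s : ℕ) (Φ : ℝ → Set (Euc d → ℝ)) (c : ℝ≥0∞) : Prop :=
  ∀ σ : ℝ, 0 < σ → ∀ f : Euc d → ℝ, MemSobolev p s f →
    bestApprox p (Φ σ) f ≤ c * (ENNReal.ofReal σ)⁻¹ ^ s * sobolevSemi p s f

/-- Bernstein-type inequality for the family `Φ`:
`|g|_{W_p^s} ≤ c σ^s ‖g‖_p` for `g ∈ Φ_σ ∩ W_p^s`. -/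
def BernsteinIneq {d : ℕ} (p : ℝ) (s : ℕ) (Φ : ℝ → Set (Euc d → ℝ)) (c : ℝ≥0∞) : Prop :=
  ∀ σ : ℝ, 0 < σ → ∀ g ∈ Φ σ, MemSobolev p s g →
    sobolevSemi p s g ≤ c * (ENNReal.ofReal σ) ^ s * LpN p g

/-- The semi-discrete K-functional `𝒦_s(f,X_σ)_p`. -/
def Kfun {d : ℕ} (p : ℝ) (s : ℕ) (σ : ℝ) (X : Set (Euc d)) (f : Euc d → ℝ) : ℝ≥0∞ :=
  ⨅ (g : Euc d → ℝ) (_ : MemSobolev p s g),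
    lpX p σ X (f - g) + LpN p (f - g) + (ENNReal.ofReal σ)⁻¹ ^ s * sobolevSemi p s g

/-- `F σ = O(σ^{-α})` as `σ → ∞`, for `ℝ≥0∞`-valued quantities. -/
def BigO (F : ℝ → ℝ≥0∞) (α : ℝ) : Prop :=
  ∃ C : ℝ≥0∞, C ≠ ∞ ∧ ∀ᶠ σ : ℝ in atTop, F σ ≤ C * ENNReal.ofReal (σ ^ (-α))

/-- The grid point `σ⁻¹ k ∈ ℝ^d` for `k ∈ ℤ^d`. -/
def gridPt {d : ℕ} (σ : ℝ) (k : Fin d → ℤ) : Euc d :=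
  (EuclideanSpace.equiv (Fin d) ℝ).symm fun i => (k i : ℝ) / σ

/-- The generalized sampling operator `S_σ^φ f(x) = ∑_{k∈ℤ^d} f(σ⁻¹k) φ(σx - k)`. -/
def samplingOp {d : ℕ} (φ : Euc d → ℝ) (σ : ℝ) (f : Euc d → ℝ) : Euc d → ℝ :=
  fun x => ∑' k : Fin d → ℤ, f (gridPt σ k) * φ (σ • x - gridPt 1 k)

/-- The univariate `sinc` function. -/
def sinc1 (t : ℝ) : ℝ := if t = 0 then 1 else Real.sin (Real.pi * t) / (Real.pi * t)

/-- The multivariate `sinc` kernel. -/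
def sincKer {d : ℕ} (x : Euc d) : ℝ := ∏ j : Fin d, sinc1 (x j)

/-- The univariate B-spline of order `r`. -/
def Bspline (r : ℕ) (u : ℝ) : ℝ :=
  (1 / ((r - 1).factorial : ℝ)) * ∑ j ∈ Finset.range (r + 1),
    (-1 : ℝ) ^ j * (r.choose j : ℝ) * max ((r : ℝ) / 2 + u - j) 0 ^ (r - 1)

/-- The tensor-product B-spline kernel `β_r`. -/
def BsplineKer {d : ℕ} (r : ℕ) (x : Euc d) : ℝ := ∏ j : Fin d, Bspline r (x j)

/-- The Gaussian kernel `ψ(x) = e^{-π|x|²}`. -/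
def gaussKer {d : ℕ} (x : Euc d) : ℝ := Real.exp (-(Real.pi * ‖x‖ ^ 2))


/-! ### Finite differences -/

/-- The translation operator `f ↦ f (· + h)`. -/
def shiftEnd {d : ℕ} (h : Euc d) : Module.End ℝ (Euc d → ℝ) :=
  LinearMap.funLeft ℝ ℝ fun x => x + h

lemma shiftEnd_pow_apply {d : ℕ} (h : Euc d) (n : ℕ) (f : Euc d → ℝ) (x : Euc d) :
    (shiftEnd h ^ n) f x = f (x + (n : ℝ) • h) := by
  induction n generalizing x with
  | zero => simp
  | succ n ih =>
    rw [pow_succ', Module.End.mul_apply]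
    change (shiftEnd h ^ n) f (x + h) = _
    rw [ih]
    congr 1
    push_cast
    module

lemma diffOp_eq_pow {d : ℕ} (h : Euc d) (r : ℕ) (f : Euc d → ℝ) :
    diffOp h r f = (((-1 : ℝ) • 1 + shiftEnd h) ^ r) f := by
  funext x
  have hc : Commute ((-1 : ℝ) • (1 : Module.End ℝ (Euc d → ℝ))) (shiftEnd h) :=
    (Commute.one_left _).smul_left _
  rw [hc.add_pow, LinearMap.sum_apply, Finset.sum_apply]
  refine Finset.sum_congr rfl fun ν _ => ?_
  have h1 : ((-1 : ℝ) • (1 : Module.End ℝ (Euc d → ℝ))) ^ ν * shiftEnd h ^ (r - ν) *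
      (r.choose ν : ℕ) = ((r.choose ν : ℝ) * (-1 : ℝ) ^ ν) • shiftEnd h ^ (r - ν) := by
    rw [← nsmul_eq_mul', mul_smul, Nat.cast_smul_eq_nsmul, smul_pow, one_pow, smul_mul_assoc,
      one_mul]
  rw [h1, LinearMap.smul_apply, Pi.smul_apply, shiftEnd_pow_apply, smul_eq_mul]

lemma diffOp_two_smul {d : ℕ} (h : Euc d) (r : ℕ) (f : Euc d → ℝ) (x : Euc d) :
    diffOp ((2 : ℝ) • h) r f x =
      ∑ k ∈ Finset.range (r + 1), (r.choose k : ℝ) * diffOp h r f (x + (k : ℝ) • h) := by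
  have h2 : shiftEnd ((2 : ℝ) • h) = shiftEnd h ^ 2 := by
    ext g y
    rw [shiftEnd_pow_apply]
    rfl
  have hfac : ((-1 : ℝ) • 1 + shiftEnd h ^ 2) = (shiftEnd h + 1) * ((-1 : ℝ) • 1 + shiftEnd h) := by
    ext g y
    simp [pow_two, mul_add, add_mul]
    ring
  have hcomm : Commute (shiftEnd h + 1) ((-1 : ℝ) • 1 + shiftEnd h) := by
    rw [commute_iff_eq, add_mul, mul_add, mul_add, add_mul]
    ext g y
    simp
    ring
  rw [diffOp_eq_pow, h2, hfac, hcomm.mul_pow, Module.End.mul_apply, ← diffOp_eq_pow,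
    (Commute.one_right (shiftEnd h)).add_pow, LinearMap.sum_apply, Finset.sum_apply]
  refine Finset.sum_congr rfl fun k _ => ?_
  rw [one_pow, mul_one, ← nsmul_eq_mul', ← Nat.cast_smul_eq_nsmul ℝ, LinearMap.smul_apply,
    Pi.smul_apply, shiftEnd_pow_apply, smul_eq_mul]

lemma sum_range_two_mul_add_one (r : ℕ) (a : ℕ → ℝ) :
    ∑ ν ∈ Finset.range (2 * r + 1), a ν =
      a r + ∑ j ∈ Finset.Icc 1 r, (a (r - j) + a (r + j)) := by
  have hI : ∀ b : ℕ → ℝ, ∑ j ∈ Finset.Icc 1 r, b j = ∑ j ∈ Finset.range r, b (j + 1) := by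
    intro b
    rw [Finset.range_eq_Ico, Finset.sum_Ico_add' b 0 r 1]
    rfl
  rw [hI, show 2 * r + 1 = r + (r + 1) by ring, Finset.sum_range_add, Finset.sum_range_succ',
    Finset.sum_add_distrib, ← Finset.sum_range_reflect]
  have : ∀ j, a (r - 1 - j) = a (r - (j + 1)) := fun j => by congr 1; omega
  simp only [this, add_zero]
  ring

/-! ### Averages over balls -/

/-- The uniform probability measure on the ball of radius `ρ` centred at the origin. -/
def unifBall (d : ℕ) (ρ : ℝ) : Measure (Euc d) :=
  ProbabilityTheory.cond volume (ball 0 ρ)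

lemma isProbabilityMeasure_unifBall (d : ℕ) {ρ : ℝ} (hρ : 0 < ρ) :
    IsProbabilityMeasure (unifBall d ρ) :=
  ProbabilityTheory.cond_isProbabilityMeasure_of_finite (measure_ball_pos _ _ hρ).ne'
    measure_ball_lt_top.ne

lemma unifBall_absolutelyContinuous (d : ℕ) (ρ : ℝ) : unifBall d ρ ≪ volume :=
  ProbabilityTheory.cond_absolutelyContinuous

lemma ae_mem_unifBall (d : ℕ) (ρ : ℝ) : ∀ᵐ u ∂unifBall d ρ, u ∈ ball (0 : Euc d) ρ :=
  ProbabilityTheory.ae_cond_mem measurableSet_ball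

lemma integral_unifBall {d : ℕ} (ρ : ℝ) (F : Euc d → ℝ) :
    ∫ u, F u ∂unifBall d ρ = ((volume (ball (0 : Euc d) ρ)).toReal)⁻¹ * ∫ u in ball 0 ρ, F u := by
  rw [unifBall, ProbabilityTheory.cond, integral_smul_measure, ENNReal.toReal_inv, smul_eq_mul]

lemma ballAvg_eq_integral_unifBall {d : ℕ} (f : Euc d → ℝ) (ρ : ℝ) (x : Euc d) :
    ballAvg f ρ x = ∫ u, f (x + u) ∂unifBall d ρ := by
  have h := (measurePreserving_add_left (volume : Measure (Euc d)) x).setIntegral_preimage_emb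
    (measurableEmbedding_addLeft x) f (ball x ρ)
  have hpre : (fun y => x + y) ⁻¹' ball x ρ = ball (0 : Euc d) ρ := by
    ext y; simp
  rw [integral_unifBall, ← hpre, h, hpre, ballAvg, setAverage_eq, smul_eq_mul, measureReal_def,
    Measure.addHaar_ball_center]

lemma ballAvg_mul_abs {d : ℕ} (f : Euc d → ℝ) {ρ c : ℝ} (hρ : 0 < ρ) (hc : c ≠ 0) (x : Euc d) :
    ballAvg f (ρ * |c|) x = ∫ u, f (x + c • u) ∂unifBall d ρ := by
  have hc' : 0 < |c| := abs_pos.mpr hc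
  rw [ballAvg_eq_integral_unifBall, integral_unifBall, integral_unifBall,
    Measure.setIntegral_comp_smul volume (fun u => f (x + u)) (ball 0 ρ) hc, _root_.smul_ball hc,
    smul_zero, Real.norm_eq_abs, mul_comm |c| ρ, Measure.addHaar_ball_of_pos _ _ hρ,
    Measure.addHaar_ball_of_pos _ _ (mul_pos hρ hc'), ENNReal.toReal_mul, ENNReal.toReal_mul,
    ENNReal.toReal_ofReal (by positivity), ENNReal.toReal_ofReal (by positivity), smul_eq_mul,
    mul_pow, abs_inv, abs_pow, mul_inv, mul_inv, mul_inv]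
  ring

lemma integrable_comp_unifBall {d : ℕ} {f : Euc d → ℝ} (hf : AEStronglyMeasurable f volume)
    {M : ℝ} (hM : ∀ x, |f x| ≤ M) {ρ : ℝ} (hρ : 0 < ρ) (x : Euc d) (c : ℝ) :
    Integrable (fun u => f (x + c • u)) (unifBall d ρ) := by
  have := isProbabilityMeasure_unifBall d hρ
  rcases eq_or_ne c 0 with rfl | hc
  · simp
  refine Integrable.of_bound ?_ M (Filter.Eventually.of_forall fun u => hM _)
  have hq : Measure.QuasiMeasurePreserving (fun u : Euc d => x + c • u) volume volume :=
    (measurePreserving_add_left volume x).quasiMeasurePreserving.comp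
      (Measure.quasiMeasurePreserving_smul volume hc)
  exact (hf.comp_quasiMeasurePreserving hq).mono_ac (unifBall_absolutelyContinuous d ρ)

lemma integral_diffOp_unifBall {d r : ℕ} (hr : 0 < r) {f : Euc d → ℝ}
    (hf : AEStronglyMeasurable f volume) {M : ℝ} (hM : ∀ x, |f x| ≤ M) {δ : ℝ} (hδ : 0 < δ)
    (x : Euc d) :
    ∫ u, diffOp ((r : ℝ)⁻¹ • u) (2 * r) f (x - u) ∂unifBall d δ =
      (-1) ^ r * ((2 * r).choose r : ℝ) * (f x - avgOp f δ r x) := by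
  have := isProbabilityMeasure_unifBall d hδ
  have hr' : (0 : ℝ) < r := by exact_mod_cast hr
  have hpt : ∀ u : Euc d, diffOp ((r : ℝ)⁻¹ • u) (2 * r) f (x - u) =
      ∑ ν ∈ Finset.range (2 * r + 1), ((2 * r).choose ν : ℝ) * (-1 : ℝ) ^ ν *
        f (x + (((r : ℝ) - ν) / r) • u) := by
    intro u
    refine Finset.sum_congr rfl fun ν hν => ?_
    have hν' : ν ≤ 2 * r := by simpa [Nat.lt_succ_iff] using hν
    congr 2
    rw [Nat.cast_sub hν', smul_smul, sub_add, sub_eq_add_neg x]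
    congr 1
    have : ((r : ℝ) - ν) / r = ((2 * r : ℕ) - ν : ℝ) * (r : ℝ)⁻¹ - 1 := by
      push_cast; field_simp; ring
    rw [this]
    module
  simp only [hpt]
  rw [integral_finsetSum _ fun ν _ => (integrable_comp_unifBall hf hM hδ x _).const_mul _]
  simp only [integral_const_mul]
  rw [sum_range_two_mul_add_one]
  have hterm : ∀ j ∈ Finset.Icc 1 r,
      ((2 * r).choose (r - j) : ℝ) * (-1 : ℝ) ^ (r - j) *
          ∫ u, f (x + (((r : ℝ) - (r - j : ℕ)) / r) • u) ∂unifBall d δ +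
        ((2 * r).choose (r + j) : ℝ) * (-1 : ℝ) ^ (r + j) *
          ∫ u, f (x + (((r : ℝ) - (r + j : ℕ)) / r) • u) ∂unifBall d δ =
      (-1) ^ r * (2 * ((-1 : ℝ) ^ j * ((2 * r).choose (r - j) : ℝ) *
        ballAvg f (δ * j / r) x)) := by
    intro j hj
    obtain ⟨hj1, hjr⟩ := Finset.mem_Icc.mp hj
    have hj' : (0 : ℝ) < j := by exact_mod_cast hj1
    have e1 : ((r : ℝ) - (r - j : ℕ)) / r = j / r := by
      rw [Nat.cast_sub hjr]; ring
    have e2 : ((r : ℝ) - (r + j : ℕ)) / r = -(j / r) := by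
      push_cast; ring
    have hpos : (0 : ℝ) < j / r := by positivity
    rw [e1, e2, ← ballAvg_mul_abs f hδ hpos.ne', ← ballAvg_mul_abs f hδ (neg_ne_zero.2 hpos.ne'),
      abs_neg, abs_of_pos hpos, mul_div_assoc,
      Nat.choose_symm_of_eq_add (show 2 * r = (r + j) + (r - j) by omega)]
    have e3 : (-1 : ℝ) ^ (r - j) = (-1) ^ r * (-1) ^ j := by
      rw [← pow_add, show r + j = (r - j) + 2 * j by omega, pow_add, pow_mul]
      simp
    rw [e3, pow_add]
    ring
  rw [Finset.sum_congr rfl hterm]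
  simp only [sub_self, zero_div, zero_smul, add_zero, integral_const, probReal_univ, one_smul]
  rw [← Finset.mul_sum, ← Finset.mul_sum, avgOp]
  have hC : ((2 * r).choose r : ℝ) ≠ 0 := by
    exact_mod_cast (Nat.choose_pos (by omega)).ne'
  field_simp
  ring

lemma enorm_avgOp_sub_le {d r : ℕ} (hr : 0 < r) {f : Euc d → ℝ}
    (hf : AEStronglyMeasurable f volume) {M : ℝ} (hM : ∀ x, |f x| ≤ M) {δ : ℝ} (hδ : 0 < δ)
    (x : Euc d) :
    ‖avgOp f δ r x - f x‖ₑ ≤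
      ∫⁻ u, ‖diffOp ((r : ℝ)⁻¹ • u) (2 * r) f (x - u)‖ₑ ∂unifBall d δ := by
  refine le_trans ?_ (enorm_integral_le_lintegral_enorm _)
  rw [integral_diffOp_unifBall hr hf hM hδ, ← ofReal_norm, ← ofReal_norm]
  refine ENNReal.ofReal_le_ofReal ?_
  have hC : (1 : ℝ) ≤ ((2 * r).choose r : ℝ) := by
    exact_mod_cast Nat.choose_pos (by omega)
  rw [norm_mul, norm_mul, norm_pow, norm_neg, norm_one, one_pow, one_mul, norm_sub_rev,
    Real.norm_natCast]
  exact le_mul_of_one_le_left (norm_nonneg _) hC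

/-! ### Discrete norms over separated sets -/

lemma sum_setLIntegral_ball_le {d : ℕ} {γ σ ρ : ℝ} {X : Set (Euc d)} (hX : Separated γ σ X)
    (hρ : ρ ≤ γ / σ) (F : Euc d → ℝ≥0∞) (s : Finset X) :
    ∑ ξ ∈ s, ∫⁻ y in ball ξ.1 ρ, F y ≤ ∫⁻ y, F y := by
  rw [← lintegral_biUnion_finset (t := fun ξ : X => ball ξ.1 ρ) _ fun _ _ => measurableSet_ball]
  · exact setLIntegral_le_lintegral _ _
  · intro ξ _ ξ' _ hne
    refine ball_disjoint_ball ?_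
    have := hX ξ.1 ξ.2 ξ'.1 ξ'.2 fun h => hne (Subtype.ext h)
    rw [mul_div_assoc] at this
    linarith

lemma lpX_le {d : ℕ} {p σ : ℝ} (hp : 1 ≤ p) (hσ : 0 < σ) {X : Set (Euc d)} {g : Euc d → ℝ}
    {D : ℝ≥0∞} (h : ∀ s : Finset X, (∑ ξ ∈ s, ‖g ξ.1‖ₑ ^ p) ^ (1 / p) ≤ D) :
    lpX p σ X g ≤ ENNReal.ofReal σ ^ (-(d : ℝ) / p) * D := by
  have hp0 : 0 < p := by linarith
  have hsum : ∑' ξ : X, ENNReal.ofReal (|g ξ.1| ^ p) ≤ D ^ p := by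
    rw [ENNReal.tsum_eq_iSup_sum]
    refine iSup_le fun s => ?_
    have := ENNReal.rpow_le_rpow (h s) hp0.le
    rw [one_div, ENNReal.rpow_inv_rpow hp0.ne'] at this
    refine le_trans (le_of_eq (Finset.sum_congr rfl fun ξ _ => ?_)) this
    rw [← ENNReal.ofReal_rpow_of_nonneg (abs_nonneg _) hp0.le, ← Real.enorm_eq_ofReal_abs]
  have hσ0 : ENNReal.ofReal σ ≠ 0 := by simpa using hσ
  calc lpX p σ X g ≤ ((ENNReal.ofReal σ)⁻¹ ^ d * D ^ p) ^ (1 / p) := by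
        unfold lpX; gcongr
    _ = _ := by
        rw [ENNReal.mul_rpow_of_nonneg _ _ (by positivity), one_div,
          ENNReal.rpow_rpow_inv hp0.ne', ← ENNReal.rpow_natCast, ENNReal.inv_rpow,
          ← ENNReal.rpow_neg, ← ENNReal.rpow_mul, div_eq_mul_inv]

lemma lp_sum_le_of_le_ballMean {d : ℕ} {γ σ ρ p : ℝ} (hp : 1 ≤ p) {X : Set (Euc d)}
    (hX : Separated γ σ X) (hρ : ρ ≤ γ / σ) {g : Euc d → ℝ} {F : Euc d → ℝ≥0∞} {S W : ℝ≥0∞}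
    (h : ∀ ξ : Euc d, ‖g ξ‖ₑ ≤ S * (W * ∫⁻ y in ball ξ ρ, F y) ^ (1 / p)) (s : Finset X) :
    (∑ ξ ∈ s, ‖g ξ.1‖ₑ ^ p) ^ (1 / p) ≤ S * W ^ (1 / p) * (∫⁻ y, F y) ^ (1 / p) := by
  have hp0 : 0 < p := by linarith
  have h1 : ∑ ξ ∈ s, ‖g ξ.1‖ₑ ^ p ≤ S ^ p * (W * ∫⁻ y, F y) := by
    calc ∑ ξ ∈ s, ‖g ξ.1‖ₑ ^ p
        ≤ ∑ ξ ∈ s, S ^ p * (W * ∫⁻ y in ball ξ.1 ρ, F y) := by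
          refine Finset.sum_le_sum fun ξ _ => ?_
          refine (ENNReal.rpow_le_rpow (h ξ.1) hp0.le).trans_eq ?_
          rw [ENNReal.mul_rpow_of_nonneg _ _ hp0.le, one_div, ENNReal.rpow_inv_rpow hp0.ne']
      _ ≤ _ := by
          rw [← Finset.mul_sum, ← Finset.mul_sum]
          gcongr
          exact sum_setLIntegral_ball_le hX hρ F s
  refine (ENNReal.rpow_le_rpow h1 (by positivity)).trans_eq ?_
  rw [ENNReal.mul_rpow_of_nonneg _ _ (by positivity), ENNReal.mul_rpow_of_nonneg _ _ (by positivity),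
    one_div, ENNReal.rpow_rpow_inv hp0.ne', mul_assoc]

lemma exists_volume_ball_rpow_le (d : ℕ) {c : ℝ} (hc : 0 < c) :
    ∃ K : ℝ≥0∞, K ≠ ∞ ∧ ∀ p δ : ℝ, 1 ≤ p → 0 < δ →
      ((volume (ball (0 : Euc d) (c * δ)))⁻¹) ^ (1 / p) ≤
        K * ENNReal.ofReal δ ^ (-(d : ℝ) / p) := by
  set v := volume (ball (0 : Euc d) c) with hv
  have hv0 : v ≠ 0 := (measure_ball_pos _ _ hc).ne'
  refine ⟨1 + v⁻¹, by simp [hv0], fun p δ hp hδ => ?_⟩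
  have hp0 : 0 < p := by linarith
  have hvol : volume (ball (0 : Euc d) (c * δ)) = ENNReal.ofReal δ ^ d * v := by
    rw [hv, Measure.addHaar_ball_of_pos _ _ hc, Measure.addHaar_ball_of_pos _ _ (mul_pos hc hδ),
      finrank_euclideanSpace_fin, mul_pow, ENNReal.ofReal_mul (by positivity),
      ENNReal.ofReal_pow hδ.le]
    ring
  have hδ0 : ENNReal.ofReal δ ^ d ≠ 0 := pow_ne_zero _ (by simpa using hδ)
  rw [hvol, ENNReal.mul_inv (.inl hδ0) (.inr hv0),
    ENNReal.mul_rpow_of_nonneg _ _ (by positivity), mul_comm]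
  refine mul_le_mul' ?_ (le_of_eq ?_)
  · rcases le_total v⁻¹ 1 with h | h
    · exact (ENNReal.rpow_le_one h (by positivity)).trans le_self_add
    · refine le_trans ?_ le_add_self
      calc v⁻¹ ^ (1 / p) ≤ v⁻¹ ^ (1 : ℝ) :=
            ENNReal.rpow_le_rpow_of_exponent_le h (by rw [div_le_one hp0]; exact hp)
        _ = v⁻¹ := ENNReal.rpow_one _
  · rw [← ENNReal.rpow_natCast, ← ENNReal.rpow_neg, ← ENNReal.rpow_mul, mul_one_div]

/-! ### The estimate by the averaged modulus -/

lemma enorm_diffOp_le_localMod {d r : ℕ} {f : Euc d → ℝ} {x t h : Euc d} {δ : ℝ}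
    (h1 : t ∈ ball x ((r : ℝ) * δ / 2)) (h2 : t + (r : ℝ) • h ∈ ball x ((r : ℝ) * δ / 2)) :
    ‖diffOp h r f t‖ₑ ≤ localMod r f x δ := by
  rw [Real.enorm_eq_ofReal_abs]
  exact le_iSup_of_le t (le_iSup_of_le h (le_iSup_of_le ⟨h1, h2⟩ le_rfl))

lemma sum_choose_mul_const (r : ℕ) (A : ℝ≥0∞) :
    ∑ k ∈ Finset.range (r + 1), (r.choose k : ℝ≥0∞) * A = 2 ^ r * A := by
  rw [← Finset.sum_mul]
  congr 1
  exact_mod_cast Nat.sum_range_choose r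

lemma enorm_diffOp_two_smul_le {d : ℕ} (h : Euc d) (r : ℕ) (f : Euc d → ℝ) (x : Euc d) :
    ‖diffOp ((2 : ℝ) • h) r f x‖ₑ ≤
      ∑ k ∈ Finset.range (r + 1), (r.choose k : ℝ≥0∞) * ‖diffOp h r f (x + (k : ℝ) • h)‖ₑ := by
  rw [diffOp_two_smul]
  refine (enorm_sum_le _ _).trans (Finset.sum_le_sum fun k _ => ?_)
  rw [enorm_mul, Real.enorm_natCast]

lemma enorm_diffOp_le_ballMean_localMod {d r : ℕ} (hr : 0 < r) {p δ : ℝ} (hp : 1 ≤ p)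
    (hδ : 0 < δ) (f : Euc d → ℝ) {ξ u : Euc d} (hu : ‖u‖ < δ) :
    ‖diffOp ((r : ℝ)⁻¹ • u) (2 * r) f (ξ - u)‖ₑ ≤
      2 ^ (2 * r) * ((volume (ball (0 : Euc d) (1 / 2 * δ)))⁻¹ *
        ∫⁻ y in ball ξ δ, localMod (2 * r) f y δ ^ p) ^ (1 / p) := by
  have hp0 : 0 < p := by linarith
  have hr' : (1 : ℝ) ≤ r := by exact_mod_cast hr
  have hr0 : (0 : ℝ) < r := by linarith
  set h : Euc d := (2 * (r : ℝ))⁻¹ • u with hh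
  have h2 : (r : ℝ)⁻¹ • u = (2 : ℝ) • h := by
    rw [hh, smul_smul]; congr 1; field_simp
  have hu0 := norm_nonneg u
  rw [h2, ← sum_choose_mul_const]
  refine (enorm_diffOp_two_smul_le _ _ _ _).trans (Finset.sum_le_sum fun k hk => ?_)
  gcongr
  have hk' : (k : ℝ) ≤ 2 * r := by
    have : k ≤ 2 * r := by simpa [Nat.lt_succ_iff] using hk
    exact_mod_cast this
  set θ : ℝ := k * (2 * (r : ℝ))⁻¹ with hθ
  have hθ0 : 0 ≤ θ := by positivity
  have hθ1 : θ ≤ 1 := by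
    rw [hθ, ← div_eq_mul_inv, div_le_one (by positivity)]; exact hk'
  have hkh : (k : ℝ) • h = θ • u := by rw [hh, smul_smul]
  rw [hkh]
  set z : Euc d := ξ + (θ - 1 / 2) • u with hz
  have hzξ : dist z ξ ≤ ‖u‖ / 2 := by
    rw [dist_eq_norm, hz, add_sub_cancel_left, norm_smul, Real.norm_eq_abs]
    have : |θ - 1 / 2| ≤ 1 / 2 := abs_le.2 ⟨by linarith, by linarith⟩
    nlinarith
  have hhalf : ‖(1 / 2 : ℝ) • u‖ = ‖u‖ / 2 := by
    rw [norm_smul]; norm_num; ring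
  have hrad : δ ≤ ((2 * r : ℕ) : ℝ) * δ / 2 := by push_cast; nlinarith
  have hloc : ∀ y ∈ ball z (1 / 2 * δ),
      ‖diffOp h (2 * r) f (ξ - u + θ • u)‖ₑ ≤ localMod (2 * r) f y δ := by
    intro y hy
    rw [mem_ball, dist_comm] at hy
    refine enorm_diffOp_le_localMod ?_ ?_
    · have e : dist (ξ - u + θ • u) z = ‖u‖ / 2 := by
        rw [dist_eq_norm, ← hhalf, ← norm_neg, hz]
        congr 1
        module
      have := dist_triangle (ξ - u + θ • u) z y
      rw [mem_ball]
      linarith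
    · have e : dist (ξ - u + θ • u + ((2 * r : ℕ) : ℝ) • h) z = ‖u‖ / 2 := by
        have : ((2 * r : ℕ) : ℝ) • h = u := by
          rw [hh, smul_smul]; push_cast
          rw [mul_inv_cancel₀ (by positivity), one_smul]
        rw [dist_eq_norm, ← hhalf, hz, this]
        congr 1
        module
      have := dist_triangle (ξ - u + θ • u + ((2 * r : ℕ) : ℝ) • h) z y
      rw [mem_ball]
      linarith
  have hsub : ball z (1 / 2 * δ) ⊆ ball ξ δ := ball_subset_ball' (by linarith)
  rw [one_div p, ENNReal.le_rpow_inv_iff hp0, mul_comm (_⁻¹), ← div_eq_mul_inv,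
    ENNReal.le_div_iff_mul_le (.inl (measure_ball_pos _ _ (by positivity)).ne')
      (.inl measure_ball_lt_top.ne), ← Measure.addHaar_ball_center volume z, ← setLIntegral_const]
  refine le_trans ?_ (lintegral_mono_set hsub)
  exact setLIntegral_mono' measurableSet_ball fun y hy => ENNReal.rpow_le_rpow (hloc y hy) hp0.le

lemma exists_lpX_avgOp_sub_le_tauMod (d : ℕ) {r : ℕ} (hr : 0 < r) :
    ∃ C : ℝ≥0∞, C ≠ ∞ ∧ ∀ (γ p σ δ : ℝ) (X : Set (Euc d)) (f : Euc d → ℝ) (M : ℝ),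
      1 ≤ p → 0 < σ → Separated γ σ X → AEStronglyMeasurable f volume → (∀ x, |f x| ≤ M) →
      0 < δ → δ ≤ γ / σ →
      lpX p σ X (avgOp f δ r - f) ≤
        C * ENNReal.ofReal (δ * σ) ^ (-(d : ℝ) / p) * tauMod p (2 * r) f δ := by
  obtain ⟨K, hK, hvol⟩ := exists_volume_ball_rpow_le d (c := 1 / 2) (by norm_num)
  refine ⟨2 ^ (2 * r) * K, ENNReal.mul_ne_top (by simp) hK,
    fun γ p σ δ X f M hp hσ hX hf hM hδ hδγ => ?_⟩
  have := isProbabilityMeasure_unifBall d hδ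
  have hpt : ∀ ξ : Euc d, ‖(avgOp f δ r - f) ξ‖ₑ ≤
      2 ^ (2 * r) * ((volume (ball (0 : Euc d) (1 / 2 * δ)))⁻¹ *
        ∫⁻ y in ball ξ δ, localMod (2 * r) f y δ ^ p) ^ (1 / p) := by
    intro ξ
    refine (enorm_avgOp_sub_le hr hf hM hδ ξ).trans ?_
    refine (lintegral_mono_ae ((ae_mem_unifBall d δ).mono fun u hu =>
      enorm_diffOp_le_ballMean_localMod hr hp hδ f (mem_ball_zero_iff.1 hu))).trans_eq ?_
    rw [lintegral_const, measure_univ, mul_one]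
  refine (lpX_le hp hσ (lp_sum_le_of_le_ballMean hp hX hδγ hpt)).trans ?_
  rw [ENNReal.ofReal_mul hδ.le, ENNReal.mul_rpow_of_ne_top ofReal_ne_top ofReal_ne_top, tauMod]
  calc _ ≤ ENNReal.ofReal σ ^ (-(d : ℝ) / p) * (2 ^ (2 * r) *
        (K * ENNReal.ofReal δ ^ (-(d : ℝ) / p)) *
          (∫⁻ y, localMod (2 * r) f y δ ^ p) ^ (1 / p)) := by
        gcongr
        exact hvol p δ hp hδ
    _ = _ := by ring

/-! ### Averages of bounded continuous functions -/

/-- Bounded continuous real functions on `ℝ^d`. -/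
def BddCont {d : ℕ} (f : Euc d → ℝ) : Prop :=
  Continuous f ∧ ∃ M : ℝ, ∀ x, |f x| ≤ M

namespace BddCont

variable {d : ℕ} {f g : Euc d → ℝ}

lemma integrable_unifBall (hf : BddCont f) {ρ : ℝ} (hρ : 0 < ρ) (x : Euc d) :
    Integrable (fun u => f (x + u)) (unifBall d ρ) := by
  obtain ⟨hc, M, hM⟩ := hf
  simpa using integrable_comp_unifBall hc.aestronglyMeasurable hM hρ x 1

lemma const_mul (hf : BddCont f) (c : ℝ) : BddCont fun x => c * f x := by
  obtain ⟨hc, M, hM⟩ := hf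
  refine ⟨hc.const_mul c, |c| * M, fun x => ?_⟩
  rw [abs_mul]
  exact mul_le_mul_of_nonneg_left (hM x) (abs_nonneg c)

lemma sub (hf : BddCont f) (hg : BddCont g) : BddCont (f - g) := by
  obtain ⟨hc, M, hM⟩ := hf
  obtain ⟨hc', M', hM'⟩ := hg
  exact ⟨hc.sub hc', M + M', fun x => (abs_sub _ _).trans (add_le_add (hM x) (hM' x))⟩

lemma sum {ι : Type*} (s : Finset ι) {F : ι → Euc d → ℝ} (hF : ∀ i ∈ s, BddCont (F i)) :
    BddCont fun x => ∑ i ∈ s, F i x := by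
  have hM : ∀ i : s, ∃ M : ℝ, ∀ x, |F i x| ≤ M := fun i => (hF i i.2).2
  choose M hM using hM
  refine ⟨continuous_finsetSum _ fun i hi => (hF i hi).1, ∑ i : s, M i, fun x => ?_⟩
  refine (Finset.abs_sum_le_sum_abs _ _).trans ?_
  rw [← Finset.sum_coe_sort s]
  exact Finset.sum_le_sum fun i _ => hM i x

lemma ballAvg (hf : BddCont f) {ρ : ℝ} (hρ : 0 < ρ) : BddCont (ballAvg f ρ) := by
  have := isProbabilityMeasure_unifBall d hρ
  obtain ⟨hc, M, hM⟩ := hf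
  have he : _root_.ballAvg f ρ = fun x => ∫ u, f (x + u) ∂unifBall d ρ :=
    funext (ballAvg_eq_integral_unifBall f ρ)
  rw [he]
  refine ⟨continuous_of_dominated (bound := fun _ => M) (fun x => ?_) (fun x => ?_)
    (integrable_const M) ?_, M, fun x => ?_⟩
  · exact (hc.comp (continuous_const_add x)).aestronglyMeasurable
  · exact Filter.Eventually.of_forall fun u => hM _
  · exact Filter.Eventually.of_forall fun u => hc.comp (continuous_add_const u)
  · have := norm_integral_le_of_norm_le_const (μ := unifBall d ρ) (f := fun u => f (x + u))
      (Filter.Eventually.of_forall fun u => hM (x + u))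
    simpa using this

end BddCont

lemma ballAvg_sub {d : ℕ} {f g : Euc d → ℝ} (hf : BddCont f) (hg : BddCont g) {ρ : ℝ}
    (hρ : 0 < ρ) (x : Euc d) : ballAvg (f - g) ρ x = ballAvg f ρ x - ballAvg g ρ x := by
  simp only [ballAvg_eq_integral_unifBall, Pi.sub_apply]
  exact integral_sub (hf.integrable_unifBall hρ x) (hg.integrable_unifBall hρ x)

lemma ballAvg_sum_const_mul {d : ℕ} {ι : Type*} (s : Finset ι) (c : ι → ℝ)
    {F : ι → Euc d → ℝ} (hF : ∀ i ∈ s, BddCont (F i)) {ρ : ℝ} (hρ : 0 < ρ) (x : Euc d) :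
    ballAvg (fun y => ∑ i ∈ s, c i * F i y) ρ x = ∑ i ∈ s, c i * ballAvg (F i) ρ x := by
  simp only [ballAvg_eq_integral_unifBall]
  rw [integral_finsetSum _ fun i hi => ((hF i hi).integrable_unifBall hρ x).const_mul _]
  simp only [integral_const_mul]

lemma ballAvg_comm {d : ℕ} {f : Euc d → ℝ} (hf : BddCont f) {a b : ℝ} (ha : 0 < a) (hb : 0 < b)
    (x : Euc d) : ballAvg (ballAvg f a) b x = ballAvg (ballAvg f b) a x := by
  have := isProbabilityMeasure_unifBall d ha
  have := isProbabilityMeasure_unifBall d hb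
  obtain ⟨hc, M, hM⟩ := hf
  simp only [ballAvg_eq_integral_unifBall]
  rw [integral_integral_swap]
  · simp only [add_right_comm]
  · refine Integrable.of_bound ?_ M (Filter.Eventually.of_forall fun u => hM _)
    exact (hc.comp (by fun_prop)).aestronglyMeasurable

/-- The weights of `avgOp` as a combination of ball averages. -/
def avgCoeff (r j : ℕ) : ℝ :=
  -(2 / ((2 * r).choose r : ℝ)) * ((-1 : ℝ) ^ j * ((2 * r).choose (r - j) : ℝ))

lemma avgOp_eq_sum {d : ℕ} (f : Euc d → ℝ) (δ : ℝ) (r : ℕ) (x : Euc d) :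
    avgOp f δ r x = ∑ j ∈ Finset.Icc 1 r, avgCoeff r j * ballAvg f (δ * j / r) x := by
  rw [avgOp, Finset.mul_sum]
  exact Finset.sum_congr rfl fun j _ => by rw [avgCoeff]; ring

lemma radius_pos {r j : ℕ} (hj : j ∈ Finset.Icc 1 r) {δ : ℝ} (hδ : 0 < δ) :
    0 < δ * j / r := by
  obtain ⟨h1, h2⟩ := Finset.mem_Icc.1 hj
  have h1' : (0 : ℝ) < j := by exact_mod_cast h1
  have h2' : (j : ℝ) ≤ r := by exact_mod_cast h2
  have : (0 : ℝ) < r := by linarith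
  positivity

lemma BddCont.avgOp {d : ℕ} {f : Euc d → ℝ} (hf : BddCont f) {δ : ℝ} (hδ : 0 < δ) (r : ℕ) :
    BddCont (avgOp f δ r) := by
  have he : _root_.avgOp f δ r = fun x =>
      ∑ j ∈ Finset.Icc 1 r, avgCoeff r j * _root_.ballAvg f (δ * j / r) x :=
    funext (avgOp_eq_sum f δ r)
  rw [he]
  exact BddCont.sum _ fun j hj => (hf.ballAvg (radius_pos hj hδ)).const_mul _

lemma avgOp_sub {d : ℕ} {f g : Euc d → ℝ} (hf : BddCont f) (hg : BddCont g) {δ : ℝ}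
    (hδ : 0 < δ) (r : ℕ) (x : Euc d) :
    avgOp (f - g) δ r x = avgOp f δ r x - avgOp g δ r x := by
  simp only [avgOp_eq_sum]
  rw [← Finset.sum_sub_distrib]
  refine Finset.sum_congr rfl fun j hj => ?_
  rw [ballAvg_sub hf hg (radius_pos hj hδ), mul_sub]

lemma avgOp_avgOp {d : ℕ} {f : Euc d → ℝ} (hf : BddCont f) {a b : ℝ} (ha : 0 < a) (hb : 0 < b)
    (r : ℕ) (x : Euc d) :
    avgOp (avgOp f a r) b r x = ∑ j ∈ Finset.Icc 1 r, ∑ i ∈ Finset.Icc 1 r,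
      avgCoeff r j * (avgCoeff r i * ballAvg (ballAvg f (a * i / r)) (b * j / r) x) := by
  rw [avgOp_eq_sum]
  refine Finset.sum_congr rfl fun j hj => ?_
  have he : avgOp f a r = fun x =>
      ∑ i ∈ Finset.Icc 1 r, avgCoeff r i * ballAvg f (a * i / r) x :=
    funext (avgOp_eq_sum f a r)
  rw [he, ballAvg_sum_const_mul _ _ (fun i hi => hf.ballAvg (radius_pos hi ha))
    (radius_pos hj hb), Finset.mul_sum]

lemma avgOp_comm {d : ℕ} {f : Euc d → ℝ} (hf : BddCont f) {a b : ℝ} (ha : 0 < a) (hb : 0 < b)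
    (r : ℕ) (x : Euc d) : avgOp (avgOp f a r) b r x = avgOp (avgOp f b r) a r x := by
  rw [avgOp_avgOp hf ha hb, avgOp_avgOp hf hb ha, Finset.sum_comm]
  refine Finset.sum_congr rfl fun i hi => Finset.sum_congr rfl fun j hj => ?_
  rw [ballAvg_comm hf (radius_pos hi ha) (radius_pos hj hb)]
  ring

lemma avgOp_sub_avgOp {d : ℕ} {f : Euc d → ℝ} (hf : BddCont f) {a b : ℝ} (ha : 0 < a)
    (hb : 0 < b) (r : ℕ) (x : Euc d) :
    avgOp f a r x - avgOp f b r x =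
      avgOp (f - avgOp f b r) a r x - avgOp (f - avgOp f a r) b r x := by
  rw [avgOp_sub hf (hf.avgOp hb r) ha, avgOp_sub hf (hf.avgOp ha r) hb, avgOp_comm hf ha hb]
  ring

lemma continuous_diffOp {d : ℕ} {f : Euc d → ℝ} (hf : Continuous f) (R : ℕ) :
    Continuous fun z : Euc d × Euc d => diffOp z.1 R f z.2 := by
  unfold diffOp
  refine continuous_finsetSum _ fun ν _ => continuous_const.mul (hf.comp ?_)
  fun_prop

lemma diffOp_zero_left {d R : ℕ} (hR : R ≠ 0) (f : Euc d → ℝ) (x : Euc d) :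
    diffOp 0 R f x = 0 := by
  have h1 : shiftEnd (0 : Euc d) = 1 := by
    ext g y
    simp [shiftEnd]
  have h2 : ((-1 : ℝ) • 1 + shiftEnd (0 : Euc d)) = 0 := by
    rw [h1]; module
  rw [diffOp_eq_pow, h2, zero_pow hR]
  rfl

lemma tendsto_avgOp {d r : ℕ} (hr : 0 < r) {f : Euc d → ℝ} (hf : BddCont f) (x : Euc d) :
    Tendsto (fun δ => avgOp f δ r x) (nhdsWithin 0 (Set.Ioi 0)) (nhds (f x)) := by
  obtain ⟨hc, M, hM⟩ := hf
  have hG : Continuous fun u : Euc d => diffOp ((r : ℝ)⁻¹ • u) (2 * r) f (x - u) :=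
    (continuous_diffOp hc (2 * r)).comp (f := fun u : Euc d => ((r : ℝ)⁻¹ • u, x - u))
      (by fun_prop)
  rw [Metric.tendsto_nhds]
  intro ε hε
  obtain ⟨η, hη, hball⟩ := Metric.continuousAt_iff.1 (hG.continuousAt (x := 0)) (ε / 2) (by linarith)
  filter_upwards [Ioo_mem_nhdsGT hη] with δ hδ
  have := isProbabilityMeasure_unifBall d hδ.1
  have hle : ‖avgOp f δ r x - f x‖ₑ ≤ ENNReal.ofReal (ε / 2) := by
    refine (enorm_avgOp_sub_le hr hc.aestronglyMeasurable hM hδ.1 x).trans ?_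
    refine (lintegral_mono_ae (g := fun _ => ENNReal.ofReal (ε / 2))
      ((ae_mem_unifBall d δ).mono fun u hu => ?_)).trans_eq ?_
    · have := hball (x := u) (by rw [dist_zero_right]; exact (mem_ball_zero_iff.1 hu).trans hδ.2)
      simp only [smul_zero] at this
      rw [diffOp_zero_left (by omega), dist_zero_right] at this
      rw [← ofReal_norm]
      exact ENNReal.ofReal_le_ofReal this.le
    · rw [lintegral_const, measure_univ, mul_one]
  rw [← ofReal_norm, ENNReal.ofReal_le_ofReal_iff (by linarith)] at hle
  rw [dist_eq_norm]
  linarith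

/-! ### The estimate by the integral of the modulus of smoothness -/

lemma lintegral_rpow_le_of_isProbabilityMeasure {α : Type*} [MeasurableSpace α] (μ : Measure α)
    [IsProbabilityMeasure μ] {p : ℝ} (hp : 1 ≤ p) {g : α → ℝ} (hg : AEStronglyMeasurable g μ) :
    (∫⁻ u, ‖g u‖ₑ ∂μ) ^ p ≤ ∫⁻ u, ‖g u‖ₑ ^ p ∂μ := by
  have hp0 : 0 < p := by linarith
  have h := eLpNorm'_le_eLpNorm'_of_exponent_le one_pos hp μ hg
  rw [lintegral_rpow_enorm_eq_rpow_eLpNorm' hp0]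
  refine ENNReal.rpow_le_rpow (le_trans (le_of_eq ?_) h) hp0.le
  simp [eLpNorm']

lemma LpN_eq {d : ℕ} {p : ℝ} (hp : 1 ≤ p) (f : Euc d → ℝ) :
    LpN p f = (∫⁻ x, ‖f x‖ₑ ^ p) ^ (1 / p) := by
  have hp0 : 0 < p := by linarith
  rw [LpN, eLpNorm_eq_lintegral_rpow_enorm_toReal (by simpa using hp0) ofReal_ne_top,
    ENNReal.toReal_ofReal hp0.le]

lemma lintegral_rpow_eq_LpN_rpow {d : ℕ} {p : ℝ} (hp : 1 ≤ p) (f : Euc d → ℝ) :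
    ∫⁻ x, ‖f x‖ₑ ^ p = LpN p f ^ p := by
  have hp0 : 0 < p := by linarith
  rw [LpN_eq hp, one_div, ENNReal.rpow_inv_rpow hp0.ne']

lemma smod_mono {d : ℕ} (p : ℝ) (R : ℕ) (f : Euc d → ℝ) : Monotone (smod p R f) := fun _ _ hst =>
  iSup_mono fun _ => iSup_mono' fun hh => ⟨hh.trans_le hst, le_rfl⟩

lemma LpN_diffOp_le_smod {d : ℕ} (p : ℝ) (R : ℕ) (f : Euc d → ℝ) {h : Euc d} {t : ℝ}
    (hh : ‖h‖ < t) : LpN p (diffOp h R f) ≤ smod p R f t :=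
  le_iSup₂_of_le h hh le_rfl

lemma smod_two_mul_le {d : ℕ} {p : ℝ} (hp : 1 ≤ p) (R : ℕ) {f : Euc d → ℝ} (hf : Continuous f)
    (t : ℝ) : smod p R f (2 * t) ≤ 2 ^ R * smod p R f t := by
  refine iSup₂_le fun h hh => ?_
  set h' : Euc d := (2 : ℝ)⁻¹ • h with hh'
  have hh2 : h = (2 : ℝ) • h' := by rw [hh', smul_smul]; norm_num
  have hnorm : ‖h'‖ < t := by
    rw [hh', norm_smul, norm_inv, Real.norm_ofNat]
    linarith
  have hcont : Continuous (diffOp h' R f) :=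
    (continuous_diffOp hf R).comp (Continuous.prodMk_right h')
  have hfun : diffOp h R f = ∑ k ∈ Finset.range (R + 1),
      (R.choose k : ℝ) • fun x => diffOp h' R f (x + (k : ℝ) • h') := by
    funext x
    rw [hh2, diffOp_two_smul, Finset.sum_apply]
    rfl
  have hshift : ∀ k : ℕ, Continuous fun x => diffOp h' R f (x + (k : ℝ) • h') := fun k =>
    hcont.comp (continuous_add_const _)
  have hp' : (1 : ℝ≥0∞) ≤ ENNReal.ofReal p := by simpa using ENNReal.ofReal_le_ofReal hp
  rw [hfun, ← sum_choose_mul_const]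
  refine (eLpNorm_sum_le (fun k _ => ((hshift k).const_smul _).aestronglyMeasurable) hp').trans
    (Finset.sum_le_sum fun k _ => ?_)
  rw [eLpNorm_const_smul, Real.enorm_natCast]
  gcongr
  refine le_trans (le_of_eq ?_) (LpN_diffOp_le_smod p R f hnorm)
  exact eLpNorm_comp_measurePreserving hcont.aestronglyMeasurable
    (measurePreserving_add_right volume ((k : ℝ) • h'))

lemma LpN_sub_avgOp_le_smod {d r : ℕ} (hr : 0 < r) {p : ℝ} (hp : 1 ≤ p) {f : Euc d → ℝ}
    (hf : BddCont f) {δ : ℝ} (hδ : 0 < δ) :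
    LpN p (f - avgOp f δ r) ≤ smod p (2 * r) f δ := by
  have hp0 : 0 < p := by linarith
  have := isProbabilityMeasure_unifBall d hδ
  obtain ⟨hc, M, hM⟩ := hf
  set G : Euc d → Euc d → ℝ := fun x u => diffOp ((r : ℝ)⁻¹ • u) (2 * r) f (x - u) with hG
  have hGc : Continuous (Function.uncurry G) :=
    (continuous_diffOp hc (2 * r)).comp
      (f := fun z : Euc d × Euc d => ((r : ℝ)⁻¹ • z.2, z.1 - z.2)) (by fun_prop)
  rw [LpN_eq hp, one_div, ENNReal.rpow_inv_le_iff hp0]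
  calc ∫⁻ x, ‖(f - avgOp f δ r) x‖ₑ ^ p
      ≤ ∫⁻ x, ∫⁻ u, ‖G x u‖ₑ ^ p ∂unifBall d δ := by
        refine lintegral_mono fun x => ?_
        refine le_trans (ENNReal.rpow_le_rpow ?_ hp0.le)
          (lintegral_rpow_le_of_isProbabilityMeasure _ hp
            (hGc.comp (Continuous.prodMk_right x)).aestronglyMeasurable)
        rw [Pi.sub_apply, ← enorm_neg, neg_sub]
        exact enorm_avgOp_sub_le hr hc.aestronglyMeasurable hM hδ x
    _ = ∫⁻ u, (∫⁻ x, ‖G x u‖ₑ ^ p) ∂unifBall d δ := by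
        refine lintegral_lintegral_swap ?_
        exact (ENNReal.continuous_rpow_const.comp hGc.enorm).measurable.aemeasurable
    _ ≤ ∫⁻ _, smod p (2 * r) f δ ^ p ∂unifBall d δ := by
        refine lintegral_mono_ae ((ae_mem_unifBall d δ).mono fun u hu => ?_)
        rw [hG, lintegral_sub_right_eq_self
          (fun x => ‖diffOp ((r : ℝ)⁻¹ • u) (2 * r) f x‖ₑ ^ p) u, lintegral_rpow_eq_LpN_rpow hp]
        refine ENNReal.rpow_le_rpow (LpN_diffOp_le_smod p _ f ?_) hp0.le
        have hr' : (1 : ℝ) ≤ r := by exact_mod_cast hr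
        rw [norm_smul, norm_inv, Real.norm_natCast]
        exact (mul_le_of_le_one_left (norm_nonneg u) (inv_le_one_of_one_le₀ hr')).trans_lt
          (mem_ball_zero_iff.1 hu)
    _ = smod p (2 * r) f δ ^ p := by rw [lintegral_const, measure_univ, mul_one]

lemma enorm_ballAvg_le {d : ℕ} {p : ℝ} (hp : 1 ≤ p) {g : Euc d → ℝ} (hg : Continuous g) {ρ : ℝ}
    (hρ : 0 < ρ) (x : Euc d) :
    ‖ballAvg g ρ x‖ₑ ≤
      ((volume (ball (0 : Euc d) ρ))⁻¹ * ∫⁻ y in ball x ρ, ‖g y‖ₑ ^ p) ^ (1 / p) := by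
  have hp0 : 0 < p := by linarith
  have := isProbabilityMeasure_unifBall d hρ
  have hpre : (fun y => x + y) ⁻¹' ball x ρ = ball (0 : Euc d) ρ := by
    ext y; simp
  rw [ballAvg_eq_integral_unifBall, one_div, ENNReal.le_rpow_inv_iff hp0]
  refine (ENNReal.rpow_le_rpow (enorm_integral_le_lintegral_enorm _) hp0.le).trans ?_
  refine (lintegral_rpow_le_of_isProbabilityMeasure _ hp
    (hg.comp (continuous_const_add x)).aestronglyMeasurable).trans_eq ?_
  simp only [Function.comp_apply]
  rw [unifBall, ProbabilityTheory.cond, lintegral_smul_measure, smul_eq_mul, ← hpre,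
    (measurePreserving_add_left (volume : Measure (Euc d)) x).setLIntegral_comp_preimage_emb
      (measurableEmbedding_addLeft x) (fun y => ‖g y‖ₑ ^ p) (ball x ρ)]

lemma sum_enorm_avgCoeff_le (r : ℕ) :
    ∑ j ∈ Finset.Icc 1 r, ‖avgCoeff r j‖ₑ ≤ 2 * (r * 2 ^ (2 * r)) := by
  have hC : (1 : ℝ) ≤ ((2 * r).choose r : ℝ) := by
    exact_mod_cast Nat.choose_pos (by omega)
  have h : ∀ j ∈ Finset.Icc 1 r, ‖avgCoeff r j‖ₑ ≤ 2 * 2 ^ (2 * r) := by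
    intro j _
    have h1 : |avgCoeff r j| ≤ 2 * 2 ^ (2 * r) := by
      rw [avgCoeff, abs_mul, abs_neg, abs_mul, abs_pow, abs_neg, abs_one, one_pow, one_mul,
        abs_div, Nat.abs_cast, Nat.abs_cast, abs_two]
      have h2 : (2 : ℝ) / ((2 * r).choose r : ℝ) ≤ 2 := div_le_self (by norm_num) hC
      have h3 : ((2 * r).choose (r - j) : ℝ) ≤ 2 ^ (2 * r) := by
        exact_mod_cast Nat.choose_le_two_pow _ _
      gcongr
    rw [Real.enorm_eq_ofReal_abs]
    refine (ENNReal.ofReal_le_ofReal h1).trans_eq ?_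
    rw [ENNReal.ofReal_mul (by norm_num), ENNReal.ofReal_pow (by norm_num), ENNReal.ofReal_ofNat]
  refine (Finset.sum_le_card_nsmul _ _ _ h).trans_eq ?_
  rw [Nat.card_Icc, add_tsub_cancel_right, nsmul_eq_mul]
  ring

lemma enorm_avgOp_le {d r : ℕ} {p : ℝ} (hp : 1 ≤ p) {g : Euc d → ℝ}
    (hg : Continuous g) {δ η : ℝ} (hδ : 0 < δ) (hηδ : η ≤ δ / r) (x : Euc d) :
    ‖avgOp g δ r x‖ₑ ≤ 2 * (r * 2 ^ (2 * r)) *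
      ((volume (ball (0 : Euc d) η))⁻¹ * ∫⁻ y in ball x δ, ‖g y‖ₑ ^ p) ^ (1 / p) := by
  have hp0 : 0 < p := by linarith
  rw [avgOp_eq_sum]
  refine (enorm_sum_le _ _).trans (le_trans ?_ (mul_le_mul_left (sum_enorm_avgCoeff_le r) _))
  rw [Finset.sum_mul]
  refine Finset.sum_le_sum fun j hj => ?_
  obtain ⟨h1, h2⟩ := Finset.mem_Icc.1 hj
  have h1' : (1 : ℝ) ≤ j := by exact_mod_cast h1
  have h2' : (j : ℝ) ≤ r := by exact_mod_cast h2
  have hr' : (0 : ℝ) < r := by linarith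
  have hle : δ * j / r ≤ δ := by
    rw [div_le_iff₀ hr']; gcongr
  have hge : η ≤ δ * j / r := by
    refine hηδ.trans ?_
    gcongr
    exact le_mul_of_one_le_right hδ.le h1'
  rw [enorm_mul]
  gcongr
  refine (enorm_ballAvg_le hp hg (radius_pos hj hδ) x).trans ?_
  gcongr

lemma lp_sum_sub_half_le {d r : ℕ} (hr : 0 < r) {γ σ p a : ℝ} (hp : 1 ≤ p) {X : Set (Euc d)}
    (hX : Separated γ σ X) (ha : 0 < a) (haγ : a ≤ γ / σ) {f : Euc d → ℝ} (hf : BddCont f)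
    (s : Finset X) :
    (∑ ξ ∈ s, ‖avgOp f a r ξ.1 - avgOp f (a / 2) r ξ.1‖ₑ ^ p) ^ (1 / p) ≤
      4 * (r * 2 ^ (2 * r)) * 2 ^ (2 * r) *
        ((volume (ball (0 : Euc d) ((2 * (r : ℝ))⁻¹ * a)))⁻¹) ^ (1 / p) *
        smod p (2 * r) f (a / 2) := by
  have hp0 : 0 < p := by linarith
  have hr' : (0 : ℝ) < r := by exact_mod_cast hr
  have ha2 : 0 < a / 2 := by linarith
  have hη1 : (2 * (r : ℝ))⁻¹ * a = (a / 2) / r := by field_simp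
  have hη2 : (2 * (r : ℝ))⁻¹ * a ≤ a / r := by rw [hη1]; gcongr; linarith
  set V := (volume (ball (0 : Euc d) ((2 * (r : ℝ))⁻¹ * a)))⁻¹ with hV
  set ω := smod p (2 * r) f (a / 2) with hω
  have hdouble : smod p (2 * r) f a ≤ 2 ^ (2 * r) * ω := by
    have := smod_two_mul_le hp (2 * r) hf.1 (a / 2)
    rwa [mul_div_cancel₀ a two_ne_zero] at this
  have hsingle : ω ≤ 2 ^ (2 * r) * ω :=
    le_mul_of_one_le_left zero_le (one_le_pow₀ (by norm_num))
  have key : ∀ b c : ℝ, 0 < b → 0 < c → b ≤ γ / σ → (2 * (r : ℝ))⁻¹ * a ≤ b / r →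
      smod p (2 * r) f c ≤ 2 ^ (2 * r) * ω →
      (∑ ξ ∈ s, ‖avgOp (f - avgOp f c r) b r ξ.1‖ₑ ^ p) ^ (1 / p) ≤
        2 * (r * 2 ^ (2 * r)) * V ^ (1 / p) * (2 ^ (2 * r) * ω) := by
    intro b c hb hc hbγ hηb hcω
    refine (lp_sum_le_of_le_ballMean hp hX hbγ
      (enorm_avgOp_le hp (hf.sub (hf.avgOp hc r)).1 hb hηb) s).trans ?_
    rw [← LpN_eq hp]
    gcongr
    exact (LpN_sub_avgOp_le_smod hr hp hf hc).trans hcω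
  calc (∑ ξ ∈ s, ‖avgOp f a r ξ.1 - avgOp f (a / 2) r ξ.1‖ₑ ^ p) ^ (1 / p)
      ≤ (∑ ξ ∈ s, (‖avgOp (f - avgOp f (a / 2) r) a r ξ.1‖ₑ +
          ‖avgOp (f - avgOp f a r) (a / 2) r ξ.1‖ₑ) ^ p) ^ (1 / p) := by
        gcongr with ξ hξ
        rw [avgOp_sub_avgOp hf ha ha2]
        exact enorm_sub_le
    _ ≤ _ := ENNReal.Lp_add_le _ _ _ hp
    _ ≤ _ := add_le_add (key a (a / 2) ha ha2 haγ hη2 hsingle)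
        (key (a / 2) a ha2 ha (by linarith) hη1.le hdouble)
    _ = _ := by ring

lemma rpow_mul_smod_half_le {d : ℕ} {p a : ℝ} (hp : 1 ≤ p) (ha : 0 < a) (R : ℕ)
    (f : Euc d → ℝ) :
    ENNReal.ofReal a ^ (-(d : ℝ) / p) * smod p R f (a / 2) ≤
      2 * ∫⁻ t in Set.Ioo (a / 2) a,
        smod p R f t * ENNReal.ofReal (t ^ (-(d : ℝ) / p - 1)) := by
  have hp0 : 0 < p := by linarith
  have hexp : -(d : ℝ) / p - 1 ≤ 0 := by
    have : 0 ≤ (d : ℝ) / p := by positivity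
    rw [neg_div]; linarith
  have hle : ∫⁻ _ in Set.Ioo (a / 2) a,
      smod p R f (a / 2) * ENNReal.ofReal (a ^ (-(d : ℝ) / p - 1)) ≤
        ∫⁻ t in Set.Ioo (a / 2) a, smod p R f t * ENNReal.ofReal (t ^ (-(d : ℝ) / p - 1)) := by
    refine setLIntegral_mono' measurableSet_Ioo fun t ht => ?_
    have ht0 : 0 < t := by linarith [ht.1]
    refine mul_le_mul' (smod_mono p R f ht.1.le) (ENNReal.ofReal_le_ofReal ?_)
    exact Real.rpow_le_rpow_of_nonpos ht0 ht.2.le hexp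
  refine le_trans (le_of_eq ?_) (mul_le_mul_right hle 2)
  have hpow : a ^ (-(d : ℝ) / p) = 2 * (a ^ (-(d : ℝ) / p - 1) * (a - a / 2)) := by
    rw [Real.rpow_sub_one ha.ne']
    field_simp
    ring
  rw [setLIntegral_const, Real.volume_Ioo, ENNReal.ofReal_rpow_of_pos ha, hpow,
    ENNReal.ofReal_mul (by norm_num), ENNReal.ofReal_mul (by positivity), ENNReal.ofReal_ofNat]
  ring

lemma sum_setLIntegral_halving_le {δ : ℝ} (hδ : 0 < δ) (F : ℝ → ℝ≥0∞) (N : ℕ) :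
    ∑ n ∈ Finset.range N, ∫⁻ t in Set.Ioo (δ / 2 ^ n / 2) (δ / 2 ^ n), F t ≤
      ∫⁻ t in Set.Ioo 0 δ, F t := by
  have hanti : Antitone fun n : ℕ => δ / 2 ^ n := fun m n hmn => by
    dsimp only
    gcongr
    norm_num
  have hdisj := hanti.pairwise_disjoint_on_Ioo_succ
  rw [← lintegral_biUnion_finset _ fun _ _ => measurableSet_Ioo]
  · refine lintegral_mono_set (Set.iUnion₂_subset fun n _ t ht => ⟨?_, ?_⟩)
    · exact lt_of_le_of_lt (by positivity) ht.1
    · exact ht.2.trans_le (div_le_self hδ.le (one_le_pow₀ (by norm_num)))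
  · intro m _ n _ hmn
    have := hdisj hmn
    simpa only [Function.onFun, Nat.succ_eq_succ, Nat.succ_eq_add_one, pow_succ, div_div] using this

lemma exists_lpX_avgOp_sub_le_smod (d : ℕ) {r : ℕ} (hr : 0 < r) :
    ∃ C : ℝ≥0∞, C ≠ ∞ ∧ ∀ (γ p σ δ : ℝ) (X : Set (Euc d)) (f : Euc d → ℝ),
      1 ≤ p → 0 < σ → Separated γ σ X → BddCont f → 0 < δ → δ ≤ γ / σ →
      lpX p σ X (avgOp f δ r - f) ≤
        C * ENNReal.ofReal σ ^ (-(d : ℝ) / p) *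
          ∫⁻ t in Set.Ioo 0 δ,
            smod p (2 * r) f t * ENNReal.ofReal (t ^ (-(d : ℝ) / p - 1)) := by
  have hr' : (0 : ℝ) < r := by exact_mod_cast hr
  obtain ⟨K, hK, hvol⟩ := exists_volume_ball_rpow_le d (c := (2 * (r : ℝ))⁻¹) (by positivity)
  set S : ℝ≥0∞ := 4 * (r * 2 ^ (2 * r)) * 2 ^ (2 * r) with hS
  have hS' : S ≠ ∞ := by
    rw [hS]
    exact ENNReal.mul_ne_top (ENNReal.mul_ne_top (by simp)
      (ENNReal.mul_ne_top (by simp) (by simp))) (by simp)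
  refine ⟨S * K * 2, ENNReal.mul_ne_top (ENNReal.mul_ne_top hS' hK) (by simp),
    fun γ p σ δ X f hp hσ hX hf hδ hδγ => ?_⟩
  have hp0 : 0 < p := by linarith
  set F : ℝ → ℝ≥0∞ := fun t =>
    smod p (2 * r) f t * ENNReal.ofReal (t ^ (-(d : ℝ) / p - 1)) with hF
  suffices h : ∀ s : Finset X, (∑ ξ ∈ s, ‖(avgOp f δ r - f) ξ.1‖ₑ ^ p) ^ (1 / p) ≤
      S * K * 2 * ∫⁻ t in Set.Ioo 0 δ, F t from
    (lpX_le hp hσ h).trans_eq (by ring)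
  intro s
  have hstep : ∀ n : ℕ, (∑ ξ ∈ s, ‖avgOp f (δ / 2 ^ n) r ξ.1 -
      avgOp f (δ / 2 ^ (n + 1)) r ξ.1‖ₑ ^ p) ^ (1 / p) ≤
        S * K * 2 * ∫⁻ t in Set.Ioo (δ / 2 ^ n / 2) (δ / 2 ^ n), F t := by
    intro n
    have ha : 0 < δ / 2 ^ n := by positivity
    have haγ : δ / 2 ^ n ≤ γ / σ := (div_le_self hδ.le (one_le_pow₀ (by norm_num))).trans hδγ
    have h := lp_sum_sub_half_le hr hp hX ha haγ hf s
    rw [show δ / 2 ^ (n + 1) = δ / 2 ^ n / 2 by rw [pow_succ, div_div]]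
    refine h.trans ?_
    calc _ ≤ S * (K * ENNReal.ofReal (δ / 2 ^ n) ^ (-(d : ℝ) / p)) *
          smod p (2 * r) f (δ / 2 ^ n / 2) := by
          gcongr
          exact hvol p _ hp ha
      _ = S * K * (ENNReal.ofReal (δ / 2 ^ n) ^ (-(d : ℝ) / p) *
          smod p (2 * r) f (δ / 2 ^ n / 2)) := by ring
      _ ≤ _ := by
          rw [mul_assoc _ (2 : ℝ≥0∞)]
          refine mul_le_mul_right ?_ _
          exact rpow_mul_smod_half_le hp ha (2 * r) f
  have hpartial : ∀ N : ℕ, (∑ ξ ∈ s, ‖avgOp f δ r ξ.1 - avgOp f (δ / 2 ^ N) r ξ.1‖ₑ ^ p) ^ (1 / p)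
      ≤ S * K * 2 * ∑ n ∈ Finset.range N,
        ∫⁻ t in Set.Ioo (δ / 2 ^ n / 2) (δ / 2 ^ n), F t := by
    intro N
    induction N with
    | zero => simp [hp0]
    | succ N ih =>
      rw [Finset.sum_range_succ, mul_add]
      refine le_trans ?_ (add_le_add ih (hstep N))
      refine le_trans ?_ (ENNReal.Lp_add_le _ _ _ hp)
      gcongr with ξ hξ
      rw [← sub_add_sub_cancel _ (avgOp f (δ / 2 ^ N) r ξ.1)]
      exact enorm_add_le _ _
  have hlim : Tendsto (fun N : ℕ => δ / 2 ^ N) atTop (nhdsWithin 0 (Set.Ioi 0)) := by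
    refine tendsto_nhdsWithin_iff.2 ⟨?_, Filter.Eventually.of_forall fun N => ?_⟩
    · have := (tendsto_pow_atTop_nhds_zero_of_lt_one (r := (2 : ℝ)⁻¹) (by norm_num)
        (by norm_num)).const_mul δ
      simpa [div_eq_mul_inv] using this
    · exact Set.mem_Ioi.2 (by positivity)
  have htend : Tendsto (fun N : ℕ =>
      (∑ ξ ∈ s, ‖avgOp f δ r ξ.1 - avgOp f (δ / 2 ^ N) r ξ.1‖ₑ ^ p) ^ (1 / p)) atTop
      (nhds ((∑ ξ ∈ s, ‖(avgOp f δ r - f) ξ.1‖ₑ ^ p) ^ (1 / p))) := by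
    refine (ENNReal.continuous_rpow_const.tendsto _).comp (tendsto_finsetSum _ fun ξ _ => ?_)
    refine (ENNReal.continuous_rpow_const.tendsto _).comp ((continuous_enorm.tendsto _).comp ?_)
    exact tendsto_const_nhds.sub ((tendsto_avgOp hr hf ξ.1).comp hlim)
  refine le_of_tendsto' htend fun N => (hpartial N).trans ?_
  gcongr
  exact sum_setLIntegral_halving_le hδ F N

/-- Proposition 2.1: estimate of `‖f_{δ,r} - f‖_{ℓ_p(X_σ)}` by the averaged modulus of
smoothness, and (for continuous `f` with `2r > d/p`) by an integral of the modulus of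
smoothness. The constant depends only on `r`, `γ`, and `d`. -/
theorem statement0 (d r : ℕ) (hr : 0 < r) (γ : ℝ) (hγ0 : 0 < γ) (hγ1 : γ ≤ 1) :
    ∃ C : ℝ≥0∞, 0 < C ∧ C ≠ ∞ ∧
      ∀ (p σ δ : ℝ) (X : Set (Euc d)) (f : Euc d → ℝ),
        1 ≤ p → 0 < σ → Separated γ σ X →
        MemLpR p f → (∃ M : ℝ, ∀ x, |f x| ≤ M) →
        0 < δ → δ ≤ γ / σ →
        (lpX p σ X (avgOp f δ r - f) ≤
            C * ENNReal.ofReal (δ * σ) ^ (-(d : ℝ) / p) * tauMod p (2 * r) f δ) ∧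
        (Continuous f → (d : ℝ) / p < 2 * r →
          lpX p σ X (avgOp f δ r - f) ≤
            C * ENNReal.ofReal σ ^ (-(d : ℝ) / p) *
              ∫⁻ t in Set.Ioo 0 δ,
                smod p (2 * r) f t * ENNReal.ofReal (t ^ (-(d : ℝ) / p - 1))) := by
  obtain ⟨C₁, hC₁, h₁⟩ := exists_lpX_avgOp_sub_le_tauMod d hr
  obtain ⟨C₂, hC₂, h₂⟩ := exists_lpX_avgOp_sub_le_smod d hr
  refine ⟨1 + C₁ + C₂, by positivity, by simp [hC₁, hC₂], ?_⟩
  intro p σ δ X f hp hσ hX hf hbdd hδ hδγ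
  obtain ⟨M, hM⟩ := hbdd
  refine ⟨(h₁ γ p σ δ X f M hp hσ hX hf.1 hM hδ hδγ).trans ?_, fun hcont _ =>
    (h₂ γ p σ δ X f hp hσ hX ⟨hcont, M, hM⟩ hδ hδγ).trans ?_⟩
  · gcongr
    exact le_add_self.trans le_self_add
  · gcongr
    exact le_add_self
end
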